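/- Let G be an ℵ₁-free abelian group and H a pure subgroup of G of finite torsion-free rank. Then the quotient group G/H is ℵ₁-free. -/

import Mathlib

/-- An abelian group is `ℵ₁`-free if every countable subgroup is free as a `ℤ`-module. -/
def Aleph1Free (G : Type*) [AddCommGroup G] : Prop :=
  ∀ H : AddSubgroup G, Countable H → Module.Free ℤ ↥H

/-- A subgroup `H` of an abelian group `G` is pure if whenever `x ∈ H` is divisible by a
nonzero integer `n` in `G`, it is divisible by `n` in `H`. -/
def IsPureSubgroup {G : Type*} [AddCommGroup G] (H : AddSubgroup G) : Prop :=
  ∀ x ∈ H, ∀ n : ℤ, n ≠ 0 → (∃ y : G, x = n • y) → ∃ h ∈ H, x = n • h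

/-- A splitting argument: a module that surjects onto a free module with free kernel is free. -/
theorem Module.Free.of_surjective_of_free_ker {R M N : Type*} [Ring R] [AddCommGroup M]
    [Module R M] [AddCommGroup N] [Module R N] (g : M →ₗ[R] N) (hg : Function.Surjective g)
    [Module.Free R N] [Module.Free R (LinearMap.ker g)] : Module.Free R M := by
  obtain ⟨s, hs⟩ := Module.projective_lifting_property g LinearMap.id hg
  have hexact : Function.Exact (LinearMap.ker g).subtype g :=
    LinearMap.exact_subtype_ker_map g
  obtain ⟨e, -⟩ := hexact.splitSurjectiveEquiv (LinearMap.ker g).injective_subtype ⟨s, hs⟩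
  exact Module.Free.of_equiv e.symm

/-- A finitely generated submodule of a free module lies in a finitely generated submodule with
free quotient. -/
theorem Submodule.FG.exists_le_ker_of_free.{u, v} {R : Type u} {M : Type v} [Ring R] [AddCommGroup M]
    [Module R M] [Module.Free R M] {K : Submodule R M} (hK : K.FG) :
    ∃ (κ : Type v) (g : M →ₗ[R] κ →₀ R),
      Function.Surjective g ∧ K ≤ LinearMap.ker g ∧ (LinearMap.ker g).FG := by
  classical
  obtain ⟨T, rfl⟩ := hK
  let b := Module.Free.chooseBasis R M
  let I : Finset (Module.Free.ChooseBasisIndex R M) := T.biUnion fun t ↦ (b.repr t).support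
  let g : M →ₗ[R] ↥((I : Set (Module.Free.ChooseBasisIndex R M))ᶜ) →₀ R :=
    Finsupp.lsubtypeDomain _ ∘ₗ b.repr.toLinearMap
  have hker : LinearMap.ker g = Submodule.span R (b '' I) := by
    ext m
    rw [b.mem_span_image, LinearMap.mem_ker]
    simp only [g, Finsupp.ext_iff, Set.subset_def, LinearMap.comp_apply]
    simp [not_imp_comm, Finsupp.lsubtypeDomain_apply]
  refine ⟨_, g, ?_, ?_, ?_⟩
  · intro f
    refine ⟨b.repr.symm (f.embDomain (Function.Embedding.subtype _)), ?_⟩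
    ext i
    simp only [g, LinearMap.comp_apply, LinearEquiv.coe_coe, LinearEquiv.apply_symm_apply,
      Finsupp.lsubtypeDomain_apply, Finsupp.subtypeDomain_apply]
    exact Finsupp.embDomain_apply_self (Function.Embedding.subtype _) f i
  · rw [hker, Submodule.span_le]
    intro t ht
    rw [SetLike.mem_coe, b.mem_span_image]
    exact_mod_cast Finset.subset_biUnion_of_mem (fun t ↦ (b.repr t).support) ht
  · rw [hker]
    exact Submodule.fg_span (I.finite_toSet.image b)

/-- Over a principal ideal domain, a torsion-free quotient of a free module by a finitely generated
submodule is free. -/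
theorem Module.Free.of_surjective_of_fg_ker {R M N : Type*} [CommRing R] [IsDomain R]
    [IsPrincipalIdealRing R] [AddCommGroup M] [Module R M] [Module.Free R M] [AddCommGroup N]
    [Module R N] [Module.IsTorsionFree R N] (p : M →ₗ[R] N) (hp : Function.Surjective p)
    (hker : (LinearMap.ker p).FG) : Module.Free R N := by
  obtain ⟨κ, g, hg, hle, hfg⟩ := hker.exists_le_ker_of_free
  let e := p.quotKerEquivOfSurjective hp
  let g' : N →ₗ[R] κ →₀ R := (LinearMap.ker p).liftQ g hle ∘ₗ e.symm.toLinearMap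
  have hg' (m : M) : g' (p m) = g m := by
    have : e.symm (p m) = (LinearMap.ker p).mkQ m := by
      rw [LinearEquiv.symm_apply_eq]; rfl
    simp [g', this]
  have hsurj : Function.Surjective g' := fun f ↦ by
    obtain ⟨m, rfl⟩ := hg f
    exact ⟨p m, hg' m⟩
  have hker' : LinearMap.ker g' = (LinearMap.ker g).map p := by
    ext n
    obtain ⟨m, rfl⟩ := hp n
    rw [LinearMap.mem_ker, hg']
    refine ⟨fun h ↦ ⟨m, h, rfl⟩, ?_⟩
    rintro ⟨m', hm', h⟩
    rw [← hg', ← h, hg']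
    exact hm'
  have : Module.Finite R (LinearMap.ker g') := .of_fg (hker' ▸ hfg.map p)
  exact .of_surjective_of_free_ker g' hsurj

/-- A torsion-free abelian group of finite rank is countable. -/
theorem countable_of_rank_lt_aleph0 {A : Type*} [AddCommGroup A] [Module.IsTorsionFree ℤ A]
    (h : Module.rank ℤ A < Cardinal.aleph0) : Countable A := by
  obtain ⟨s, hs, hli⟩ := exists_set_linearIndependent ℤ A
  have hfin : Finite s := by rwa [← Cardinal.lt_aleph0_iff_finite, hs]
  let S : Submodule ℤ A := Submodule.span ℤ s
  have hrank : Module.rank ℤ (A ⧸ S) = 0 := by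
    have hS : Module.rank ℤ S = Module.rank ℤ A := by rw [← hs]; exact rank_span_set hli
    have hsum := rank_quotient_add_rank_of_isDomain S
    rw [hS] at hsum
    nth_rewrite 2 [← zero_add (Module.rank ℤ A)] at hsum
    exact Cardinal.eq_of_add_eq_add_right hsum h
  have htors (x : A) : ∃ n : ℤ, n ≠ 0 ∧ n • x ∈ S := by
    obtain ⟨n, hn, hx⟩ := rank_eq_zero_iff.1 hrank (S.mkQ x)
    exact ⟨n, hn, by rwa [← map_smul, Submodule.mkQ_apply, Submodule.Quotient.mk_eq_zero] at hx⟩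
  choose n hn hmem using htors
  have : Countable S := by
    have : Module.Finite ℤ S := Module.Finite.span_of_finite ℤ (Set.toFinite s)
    obtain ⟨k, f, hf⟩ := Module.Finite.exists_fin' ℤ S
    exact hf.countable
  refine Function.Injective.countable (f := fun x ↦ (n x, (⟨n x • x, hmem x⟩ : S))) ?_
  intro x y hxy
  simp only [Prod.mk.injEq, Subtype.mk.injEq] at hxy
  obtain ⟨h1, h2⟩ := hxy
  rw [← h1] at h2
  exact smul_right_injective A (hn x) h2

theorem Aleph1Free.isTorsionFree {G : Type*} [AddCommGroup G] (hG : Aleph1Free G) :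
    Module.IsTorsionFree ℤ G := by
  rw [Module.isTorsionFree_iff_smul_eq_zero]
  intro n x hx
  have : Module.Free ℤ (AddSubgroup.zmultiples x) := hG _ inferInstance
  have h : n • (⟨x, AddSubgroup.mem_zmultiples x⟩ : AddSubgroup.zmultiples x) = 0 :=
    Subtype.ext hx
  simpa using smul_eq_zero.1 h

theorem IsPureSubgroup.isTorsionFree_quotient {G : Type*} [AddCommGroup G]
    [Module.IsTorsionFree ℤ G] {H : AddSubgroup G} (hH : IsPureSubgroup H) :
    Module.IsTorsionFree ℤ (G ⧸ H) := by
  rw [Module.isTorsionFree_iff_smul_eq_zero]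
  intro n x hx
  obtain ⟨y, rfl⟩ := QuotientAddGroup.mk_surjective x
  rw [or_iff_not_imp_left]
  intro hn
  rw [← QuotientAddGroup.mk_zsmul, QuotientAddGroup.eq_zero_iff] at hx
  obtain ⟨h, hh, hyh⟩ := hH _ hx n hn ⟨y, rfl⟩
  rw [QuotientAddGroup.eq_zero_iff, smul_right_injective G hn hyh]
  exact hh

/-- If `G` is an `ℵ₁`-free abelian group and `H` is a pure subgroup of `G` of finite
torsion-free rank, then `G/H` is `ℵ₁`-free. -/
theorem aleph1Free_quotient_of_pure_finiteRank {G : Type*} [AddCommGroup G]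
    (hG : Aleph1Free G) (H : AddSubgroup G) (hpure : IsPureSubgroup H)
    (hrk : Module.rank ℤ ↥H < Cardinal.aleph0) :
    Aleph1Free (G ⧸ H) := by
  intro K hK
  have := hG.isTorsionFree
  have : Module.IsTorsionFree ℤ (G ⧸ H) := hpure.isTorsionFree_quotient
  have : Module.IsTorsionFree ℤ K := K.toIntSubmodule.instIsTorsionFree
  have : Module.IsTorsionFree ℤ H := H.toIntSubmodule.instIsTorsionFree
  have hHc : Countable H := countable_of_rank_lt_aleph0 hrk
  have : Module.Free ℤ H := hG H hHc
  have : Module.Finite ℤ H := Module.rank_lt_aleph0_iff.1 hrk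
  let L : AddSubgroup G := K.comap (QuotientAddGroup.mk' H)
  let q : L →+ K := (QuotientAddGroup.mk' H).addSubgroupComap K
  have hq : Function.Surjective q :=
    AddMonoidHom.addSubgroupComap_surjective_of_surjective _ _ (QuotientAddGroup.mk'_surjective H)
  have hHL : H ≤ L := fun x hx ↦ by
    have : (QuotientAddGroup.mk' H) x = 0 := (QuotientAddGroup.eq_zero_iff x).2 hx
    simp [L, this]
  have hker : LinearMap.ker q.toIntLinearMap
      = LinearMap.range (AddSubgroup.inclusion hHL).toIntLinearMap := by
    ext x
    have : q x = 0 ↔ (x : G) ∈ H := by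
      rw [← QuotientAddGroup.eq_zero_iff, Subtype.ext_iff]; rfl
    refine this.trans ⟨fun h ↦ ⟨⟨x, h⟩, rfl⟩, ?_⟩
    rintro ⟨y, rfl⟩
    exact y.2
  have hLc : Countable L := by
    obtain ⟨s, hs⟩ := hq.hasRightInverse
    refine Function.Surjective.countable (f := fun kh : K × H ↦ s kh.1 + ⟨kh.2, hHL kh.2.2⟩) ?_
    intro x
    have hx : x - s (q x) ∈ LinearMap.ker q.toIntLinearMap := by
      rw [LinearMap.mem_ker, AddMonoidHom.coe_toIntLinearMap, map_sub, hs, sub_self]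
    rw [hker] at hx
    obtain ⟨h, hh⟩ := hx
    exact ⟨(q x, h), (sub_eq_iff_eq_add'.1 hh.symm).symm⟩
  have : Module.Free ℤ L := hG L hLc
  refine .of_surjective_of_fg_ker q.toIntLinearMap hq ?_
  rw [hker]
  exact Submodule.fg_range _
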